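/- Fix 1 ≤ e ≤ r−1 and 1 ≤ i ≤ r. Define p_h on spins by p_h(d_e) = d_{e+1} and p_h(x) = x for every other spin x, and define p_v on multiplicity functions m : {1,…,r}×{1,…,r} → ℕ by (p_v m)(a, e+1) = m(a,e) + m(a,e+1), (p_v m)(a,e) = 0, and (p_v m)(a,b) = m(a,b) for b ∉ {e, e+1}. Then for every spin A with A ≠ d_e, every multiplicity function D with D(a,e) = 0 for all a, every multiplicity function b, and every spin c: W(A, p_v(b), p_h(c), D) = Σ_{a : p_h(a) = A} Σ_{d : p_v(d) = D} W(a, b, c, d) in ℤ[t][z_1,…,z_r] (the sums being over spins a and multiplicity functions d, and both sums are finite). -/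

import Mathlib

/-- A spin: `Sum.inl a` is the color `c_{a+1}`, `Sum.inr b` is the dolor `d_{b+1}`
(so indices are 0-based). -/
abbrev Spin (r : ℕ) := Fin r ⊕ Fin r

/-- The `k`-th boson (0-indexed) in the monochrome ordering:
`(c_a, d_b) < (c_{a'}, d_{b'})` iff `b > b'`, or `b = b'` and `a < a'`.
A boson is recorded as the pair (color index, dolor index), 0-based. -/
def bosonOfIdx {r : ℕ} (k : Fin (r * r)) : Fin r × Fin r :=
  have hr : 0 < r := by
    rcases Nat.eq_zero_or_pos r with h | h
    · exact absurd k.2 (by simp [h])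
    · exact h
  (⟨k.val % r, Nat.mod_lt _ hr⟩,
   ⟨r - 1 - k.val / r, lt_of_le_of_lt (Nat.sub_le _ _) (Nat.sub_lt hr one_pos)⟩)

/-- One admissibility step at boson `ab = (a,b)`, from spin `x` to spin `y`,
where `m` is the multiplicity function on the top edge and `m'` on the bottom edge:
either a pass, a split, or a merge. -/
def StepOK {r : ℕ} (m m' : Fin r × Fin r → ℕ) (ab : Fin r × Fin r)
    (x y : Spin r) : Prop :=
  (y = x ∧ m' ab = m ab) ∨
  (x = Sum.inr ab.2 ∧ y = Sum.inl ab.1 ∧ m ab = m' ab + 1) ∨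
  (x = Sum.inl ab.1 ∧ y = Sum.inr ab.2 ∧ m' ab = m ab + 1)

/-- Admissibility of a vertex datum: left spin `l`, top multiplicities `m`,
right spin `rr`, bottom multiplicities `m'`. -/
def AdmissibleVertex {r : ℕ} (l : Spin r) (m : Fin r × Fin r → ℕ) (rr : Spin r)
    (m' : Fin r × Fin r → ℕ) : Prop :=
  ∃ x : Fin (r * r + 1) → Spin r, x 0 = l ∧ x (Fin.last _) = rr ∧
    ∀ k : Fin (r * r), StepOK m m' (bosonOfIdx k) (x k.castSucc) (x k.succ)

/-- The coefficient ring `ℤ[t][z_1,…,z_r]`, with `t = X none` and `z_{i+1} = X (some i)`. -/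
abbrev PolyR (r : ℕ) := MvPolynomial (Option (Fin r)) ℤ

/-- The variable `t`. -/
noncomputable def tP (r : ℕ) : PolyR r := MvPolynomial.X none

/-- The variable `z_{i+1}`. -/
noncomputable def zP {r : ℕ} (i : Fin r) : PolyR r := MvPolynomial.X (some i)

/-- Weight of a pass step at boson `ab`, where the horizontal spin is `x`,
`n` is the number of bosons on the (equal) vertical edges, and `zi` is the row parameter. -/
noncomputable def passWeight {r : ℕ} (zi : PolyR r) (n : ℕ) (ab : Fin r × Fin r)
    (x : Spin r) : PolyR r :=
  match x with
  | Sum.inl e => if e = ab.1 then zi else if e < ab.1 then tP r ^ n else 1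
  | Sum.inr e =>
      if e = ab.2 then 1
      else if ab.1.val = 0 then (if e < ab.2 then tP r ^ n * zi else zi)
      else (if e < ab.2 then tP r ^ n else 1)

/-- Weight of the step at boson `ab` with top multiplicity `m`, bottom multiplicity `m'`
and incoming horizontal spin `x`. -/
noncomputable def stepWeight {r : ℕ} (zi : PolyR r) (m m' : ℕ) (ab : Fin r × Fin r)
    (x : Spin r) : PolyR r :=
  if m = m' + 1 then ∑ j ∈ Finset.range (min m m' + 1), tP r ^ j
  else if m' = m + 1 then (1 - tP r) * zi
  else passWeight zi (min m m') ab x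

/-- The (necessarily unique) next horizontal spin at a boson `ab`. -/
def nextSpin {r : ℕ} (m m' : Fin r × Fin r → ℕ) (ab : Fin r × Fin r) (x : Spin r) : Spin r :=
  if m ab = m' ab + 1 then Sum.inl ab.1
  else if m' ab = m ab + 1 then Sum.inr ab.2
  else x

/-- The sequence of horizontal spins inside a vertex, starting from the left spin `l`.
For an admissible vertex this coincides with the unique admissibility sequence. -/
def pathSpin {r : ℕ} (m m' : Fin r × Fin r → ℕ) (l : Spin r) : ℕ → Spin r
  | 0 => l
  | k + 1 =>
      if h : k < r * r then nextSpin m m' (bosonOfIdx ⟨k, h⟩) (pathSpin m m' l k)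
      else pathSpin m m' l k

/-- Boltzmann weight of an admissible vertex with row parameter `zi`, left spin `l`,
top multiplicities `m` and bottom multiplicities `m'`. -/
noncomputable def vertexWeight {r : ℕ} (zi : PolyR r) (l : Spin r)
    (m m' : Fin r × Fin r → ℕ) : PolyR r :=
  ∏ k : Fin (r * r),
    stepWeight zi (m (bosonOfIdx k)) (m' (bosonOfIdx k)) (bosonOfIdx k)
      (pathSpin m m' l k.val)

open Classical in
/-- `W(l, m, rr, m')`: the weight of the vertex datum if admissible, and `0` otherwise. -/
noncomputable def Wvert {r : ℕ} (zi : PolyR r) (l : Spin r) (m : Fin r × Fin r → ℕ)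
    (rr : Spin r) (m' : Fin r × Fin r → ℕ) : PolyR r :=
  if AdmissibleVertex l m rr m' then vertexWeight zi l m m' else 0

/-- A filling of the `r × N` grid: `m i j` are the boson multiplicities on the vertical
edge of column `j` between rows `i` and `i+1` (row `0` is the top boundary),
and `h i j` is the horizontal spin of row `i+1` immediately to the right of column `j`
(`j = N` is the left boundary, `j = 0` the right boundary). -/
structure Filling (r N : ℕ) where
  m : Fin (r + 1) → Fin N → Fin r × Fin r → ℕ
  h : Fin r → Fin (N + 1) → Spin r

/-- A state: every vertex is admissible. -/
def Filling.IsState {r N : ℕ} (f : Filling r N) : Prop :=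
  ∀ (i : Fin r) (j : Fin N),
    AdmissibleVertex (f.h i j.succ) (f.m i.castSucc j) (f.h i j.castSucc) (f.m i.succ j)

/-- Membership in the system `S(λ; w_1, w_2, w_3, w_4)`. -/
def InSystem {r N : ℕ} (lam : Fin r → ℕ) (w1 w2 w3 w4 : Equiv.Perm (Fin r))
    (f : Filling r N) : Prop :=
  f.IsState ∧
  (∀ (j : Fin N) (a b : Fin r),
      f.m 0 j (a, b) =
        (Finset.univ.filter fun i : Fin r =>
            lam i = j.val ∧ w3⁻¹ i = a ∧ w4⁻¹ (Fin.rev i) = b).card) ∧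
  (∀ (j : Fin N) (ab : Fin r × Fin r), f.m (Fin.last r) j ab = 0) ∧
  (∀ i : Fin r, f.h i 0 = Sum.inl (w1⁻¹ i)) ∧
  (∀ i : Fin r, f.h i (Fin.last N) = Sum.inr (w2⁻¹ i))

/-- The Boltzmann weight of a state: the product of the weights of its vertices. -/
noncomputable def stateWeight {r N : ℕ} (f : Filling r N) : PolyR r :=
  ∏ i : Fin r, ∏ j : Fin N,
    vertexWeight (zP i) (f.h i j.succ) (f.m i.castSucc j) (f.m i.succ j)

open Classical in
/-- The partition function `Z(λ; w_1, w_2, w_3, w_4)`: the sum of the weights of the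
states of the system (a finite sum, expressed via `finsum`). -/
noncomputable def partitionZ (r N : ℕ) (lam : Fin r → ℕ)
    (w1 w2 w3 w4 : Equiv.Perm (Fin r)) : PolyR r :=
  finsum fun f : Filling r N =>
    if InSystem lam w1 w2 w3 w4 f then stateWeight f else 0

/-- The state `f` has a merge at vertex `(i+1, j)`. -/
def HasMergeAt {r N : ℕ} (f : Filling r N) (i : Fin r) (j : Fin N) : Prop :=
  ∃ ab : Fin r × Fin r, f.m i.castSucc j ab < f.m i.succ j ab

/-- `ℓ(w)`: the number of inversions of a permutation. -/
def invCount {r : ℕ} (w : Equiv.Perm (Fin r)) : ℕ :=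
  (Finset.univ.filter fun p : Fin r × Fin r => p.1 < p.2 ∧ w p.2 < w p.1).card

/-- A transposition in `S_r`. -/
def IsTransposition {r : ℕ} (t : Equiv.Perm (Fin r)) : Prop :=
  ∃ a b : Fin r, a ≠ b ∧ t = Equiv.swap a b

/-- Bruhat order on `S_r`. -/
def bruhatLE {r : ℕ} (u v : Equiv.Perm (Fin r)) : Prop :=
  Relation.ReflTransGen
    (fun x y => ∃ t, IsTransposition t ∧ y = x * t ∧ invCount x < invCount y) u v


/-! ### Ordered products of matrices -/

def matProd {ι R : Type*} [Fintype ι] [DecidableEq ι] [CommRing R]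
    (f : ℕ → Matrix ι ι R) : ℕ → Matrix ι ι R
  | 0 => 1
  | k + 1 => matProd f k * f k

section MatProd
variable {ι R : Type*} [Fintype ι] [DecidableEq ι] [CommRing R]

theorem matProd_add (f : ℕ → Matrix ι ι R) (m n : ℕ) :
    matProd f (m + n) = matProd f m * matProd (fun k => f (m + k)) n := by
  induction n with
  | zero => simp [matProd]
  | succ n ih => rw [← add_assoc]; simp only [matProd]; rw [ih, Matrix.mul_assoc]

theorem matProd_congr (f g : ℕ → Matrix ι ι R) (n : ℕ) (h : ∀ k < n, f k = g k) :
    matProd f n = matProd g n := by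
  induction n with
  | zero => rfl
  | succ n ih =>
    simp only [matProd]
    rw [ih (fun k hk => h k (by omega)), h n (by omega)]

theorem matProd_intertwine (P : Matrix ι ι R) (f g : ℕ → Matrix ι ι R) (n : ℕ)
    (h : ∀ k < n, P * f k = g k * P) : P * matProd f n = matProd g n * P := by
  induction n with
  | zero => simp [matProd]
  | succ n ih =>
    simp only [matProd]
    rw [← Matrix.mul_assoc, ih (fun k hk => h k (by omega)), Matrix.mul_assoc, h n (by omega),
      Matrix.mul_assoc]

theorem matProd_conj (U U' : Matrix ι ι R) (h1 : U' * U = 1) (h2 : U * U' = 1)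
    (c : ℕ → R) (f : ℕ → Matrix ι ι R) (n : ℕ) :
    matProd (fun k => c k • (U * f k * U')) n
      = (∏ k ∈ Finset.range n, c k) • (U * matProd f n * U') := by
  induction n with
  | zero => simp [matProd, h2]
  | succ n ih =>
    simp only [matProd]
    rw [ih, Finset.prod_range_succ, Matrix.smul_mul, Matrix.mul_smul, smul_smul]
    congr 1
    calc U * matProd f n * U' * (U * f n * U')
        = U * matProd f n * (U' * U) * f n * U' := by simp only [Matrix.mul_assoc]
      _ = _ := by rw [h1, Matrix.mul_one]; simp only [Matrix.mul_assoc]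

theorem matProd_map {S : Type*} [CommRing S] (φ : R →+* S) (f : ℕ → Matrix ι ι R) (n : ℕ) :
    (matProd f n).map φ = matProd (fun k => (f k).map φ) n := by
  induction n with
  | zero => simp [matProd]
  | succ n ih => simp only [matProd]; rw [Matrix.map_mul, ih]

end MatProd

/-! ### Generic step matrices -/

section Core
variable {r : ℕ} {R : Type*} [CommRing R]

def passG (t z : R) (n : ℕ) (ab : Fin r × Fin r) (x : Spin r) : R :=
  match x with
  | Sum.inl e => if e = ab.1 then z else if e < ab.1 then t ^ n else 1
  | Sum.inr e =>
      if e = ab.2 then 1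
      else if ab.1.val = 0 then (if e < ab.2 then t ^ n * z else z)
      else (if e < ab.2 then t ^ n else 1)

def stepM (t z : R) (n : ℕ) (v : R) (ab : Fin r × Fin r) : Matrix (Spin r) (Spin r) R :=
  fun x y =>
    if y = x then passG t z n ab x * v ^ n
    else if x = Sum.inr ab.2 ∧ y = Sum.inl ab.1 then (∑ j ∈ Finset.range n, t ^ j) * v ^ (n - 1)
    else if x = Sum.inl ab.1 ∧ y = Sum.inr ab.2 then (1 - t) * z * v ^ (n + 1)
    else 0

/-- Right multiplication by a step matrix. -/
theorem mul_stepM (M : Matrix (Spin r) (Spin r) R) (t z : R) (n : ℕ) (v : R)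
    (ab : Fin r × Fin r) (x y : Spin r) :
    (M * stepM t z n v ab) x y = M x y * (passG t z n ab y * v ^ n)
      + (if y = Sum.inl ab.1 then
          M x (Sum.inr ab.2) * ((∑ j ∈ Finset.range n, t ^ j) * v ^ (n - 1)) else 0)
      + (if y = Sum.inr ab.2 then M x (Sum.inl ab.1) * ((1 - t) * z * v ^ (n + 1)) else 0) := by
  rw [Matrix.mul_apply]
  have key : ∀ w, M x w * stepM t z n v ab w y =
      (if w = y then M x y * (passG t z n ab y * v ^ n) else 0)
      + (if w = Sum.inr ab.2 then (if y = Sum.inl ab.1 then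
          M x (Sum.inr ab.2) * ((∑ j ∈ Finset.range n, t ^ j) * v ^ (n - 1)) else 0) else 0)
      + (if w = Sum.inl ab.1 then
        (if y = Sum.inr ab.2 then M x (Sum.inl ab.1) * ((1 - t) * z * v ^ (n + 1)) else 0)
          else 0) := by
    intro w
    unfold stepM
    by_cases h1 : y = w
    · subst h1
      rcases y with y | y <;> simp
    · rw [if_neg h1, if_neg (Ne.symm h1)]
      rcases w with w | w <;> rcases y with y | y <;> simp <;> split_ifs <;> simp_all
  simp_rw [key, Finset.sum_add_distrib, Finset.sum_ite_eq', Finset.mem_univ, if_true]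

theorem stepM_conj {K : Type*} [Field K] (t z : K) (n : ℕ) (ab : Fin r × Fin r)
    (w : Fin r → K) (hw : ∀ a, w a ≠ 0) :
    stepM t z n (w ab.1) ab = (w ab.1) ^ n •
      (Matrix.diagonal (Sum.elim w (fun _ => 1)) * stepM t z n 1 ab *
        Matrix.diagonal (fun x => (Sum.elim w (fun _ => 1) x)⁻¹)) := by
  ext x y
  rw [Matrix.smul_apply, Matrix.mul_diagonal, Matrix.diagonal_mul]
  have h1 := hw ab.1
  unfold stepM
  by_cases h : y = x
  · subst h
    have : (Sum.elim w (fun _ => (1:K)) y) ≠ 0 := by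
      rcases y with y | y <;> simp [hw]
    simp only [if_true, smul_eq_mul]
    field_simp
    simp
  · rw [if_neg h, if_neg h]
    by_cases h2 : x = Sum.inr ab.2 ∧ y = Sum.inl ab.1
    · rw [if_pos h2, if_pos h2, h2.1, h2.2]
      rcases n with _ | n
      · simp
      · simp; field_simp; ring
    · rw [if_neg h2, if_neg h2]
      by_cases h3 : x = Sum.inl ab.1 ∧ y = Sum.inr ab.2
      · rw [if_pos h3, if_pos h3, h3.1, h3.2]
        simp; ring
      · rw [if_neg h3, if_neg h3]; simp

theorem stepM_map {S : Type*} [CommRing S] (φ : R →+* S) (t z : R) (n : ℕ) (v : R)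
    (ab : Fin r × Fin r) :
    (stepM t z n v ab).map φ = stepM (φ t) (φ z) n (φ v) ab := by
  ext x y
  rw [Matrix.map_apply]
  unfold stepM
  have : φ (passG t z n ab x) = passG (φ t) (φ z) n ab x := by
    unfold passG
    rcases x with x | x <;> simp only [] <;> split_ifs <;> simp
  split_ifs <;> simp [this]

/-! ### One block -/

/-- The product over the first `s` colors of the (ungraded) step matrices for the dolor `f`. -/
def blk (t z : R) (n : ℕ → ℕ) (f : Fin r) (s : ℕ) : Matrix (Spin r) (Spin r) R :=
  matProd (fun a => if h : a < r then stepM t z (n a) 1 (⟨a, h⟩, f) else 1) s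

def qn (t : R) (n : ℕ) : R := ∑ j ∈ Finset.range n, t ^ j

/-- Closed form of `blk`. -/
def blkC (t z : R) (n : ℕ → ℕ) (f : Fin r) (s : ℕ) : Matrix (Spin r) (Spin r) R :=
  fun x y => match x, y with
  | Sum.inr h, Sum.inr h' => if h = h' then (if h = f then 1 else (if 0 < s then z else 1) *
      (if h < f then t ^ (∑ a ∈ Finset.Ico 0 s, n a) else 1)) else 0
  | Sum.inr h, Sum.inl y => if h = f ∧ y.val < s then
      qn t (n y) * t ^ (∑ a ∈ Finset.Ico (y.val + 1) s, n a) else 0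
  | Sum.inl x, Sum.inr h => if h = f ∧ x.val < s then (1 - t) * z else 0
  | Sum.inl x, Sum.inl y => if x = y then
      (if x.val < s then z * t ^ (∑ a ∈ Finset.Ico (x.val + 1) s, n a) else 1)
      else if x.val < y.val ∧ y.val < s then
        (1 - t) * z * (qn t (n y) * t ^ (∑ a ∈ Finset.Ico (y.val + 1) s, n a)) else 0

theorem blk_eq (t z : R) (n : ℕ → ℕ) (f : Fin r) (s : ℕ) (hs : s ≤ r) :
    blk t z n f s = blkC t z n f s := by
  induction s with
  | zero =>
    ext x y
    rcases x with x | x <;> rcases y with y | y <;>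
      simp [blk, matProd, blkC, Matrix.one_apply]
  | succ s ih =>
    have hsr : s < r := hs
    have : blk t z n f (s+1) = blkC t z n f s * stepM t z (n s) 1 (⟨s, hsr⟩, f) := by
      rw [← ih (by omega)]
      unfold blk
      rw [matProd, dif_pos hsr]
    rw [this]
    ext x y
    rw [mul_stepM]
    have hI : ∀ j, j ≤ s → ∑ a ∈ Finset.Ico j (s+1), n a = ∑ a ∈ Finset.Ico j s, n a + n s :=
      fun j hj => Finset.sum_Ico_succ_top hj _
    rcases x with x | x <;> rcases y with y | y
    · by_cases hxy : x = y
      on_goal 1 => subst hxy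
      all_goals simp only [blkC, passG, one_pow, mul_one, Sum.inl.injEq, reduceCtorEq, if_false, add_zero,
        true_and, Fin.ext_iff, Fin.lt_def, qn]
      on_goal 1 => rcases lt_trichotomy x.val s with hy | hy | hy
      on_goal 4 => rcases lt_trichotomy y.val s with hy | hy | hy
      · rw [hI _ hy]
        split_ifs <;> first | omega | simp [pow_add, mul_assoc]
      · subst hy
        split_ifs <;> first | omega | simp
      · split_ifs <;> first | omega | simp
      · rw [hI _ hy]
        split_ifs <;> first | omega | simp [pow_add, mul_assoc]
      · subst hy
        split_ifs <;> first | omega | simp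
      · split_ifs <;> first | omega | simp
    · simp only [blkC, passG, one_pow, mul_one, Sum.inr.injEq, reduceCtorEq, if_false, add_zero,
        true_and, Fin.ext_iff, Fin.lt_def, qn]
      split_ifs <;> first | omega | simp
    · simp only [blkC, passG, one_pow, mul_one, Sum.inl.injEq, reduceCtorEq, if_false, add_zero,
        true_and, Fin.ext_iff, Fin.lt_def, qn]
      rcases lt_trichotomy y.val s with hy | hy | hy
      · rw [hI _ hy]
        split_ifs <;> first | omega | simp [pow_add, mul_assoc]
      · subst hy
        split_ifs <;> first | omega | simp
      · split_ifs <;> first | omega | simp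
    · simp only [blkC, passG, one_pow, mul_one, Sum.inr.injEq, reduceCtorEq, if_false, add_zero,
        true_and, Fin.ext_iff, Fin.lt_def, qn, hI 0 (Nat.zero_le _)]
      rcases Nat.eq_zero_or_pos s with h0 | h0
      · subst h0
        split_ifs <;> first | omega | simp [mul_comm]
      · split_ifs <;> first | omega | simp [pow_add, mul_assoc]

theorem qn_mul (t : R) (n : ℕ) : (1 - t) * qn t n = 1 - t ^ n := by
  unfold qn; exact mul_neg_geom_sum t n

theorem qn_add (t : R) (m n : ℕ) : qn t (m + n) = qn t m + t ^ m * qn t n := by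
  unfold qn
  rw [Finset.sum_range_add, Finset.mul_sum]
  simp only [pow_add]

theorem telescope (t : R) (n : ℕ → ℕ) (s lo y : ℕ) (h1 : lo ≤ y) (h2 : y ≤ s) :
    (1 - t) * ∑ x ∈ Finset.Ico lo y, qn t (n x) * t ^ (∑ a ∈ Finset.Ico (x + 1) s, n a)
      = t ^ (∑ a ∈ Finset.Ico y s, n a) - t ^ (∑ a ∈ Finset.Ico lo s, n a) := by
  induction y, h1 using Nat.le_induction with
  | base => simp
  | succ y hy ih =>
    rw [Finset.sum_Ico_succ_top hy, mul_add, ih (by omega), ← mul_assoc, qn_mul,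
      Finset.sum_eq_sum_Ico_succ_bot (show y < s by omega) n, pow_add]
    ring

end Core

section Core2
variable {r : ℕ} {R : Type*} [CommRing R]

theorem sum_fin_Ico (F : ℕ → R) (lo y : ℕ) (h : y ≤ r) :
    (∑ x : Fin r, if lo ≤ x.val ∧ x.val < y then F x.val else 0) = ∑ x ∈ Finset.Ico lo y, F x := by
  rw [← Finset.sum_range (fun x => if lo ≤ x ∧ x < y then F x else 0), ← Finset.sum_filter]
  apply Finset.sum_congr _ (fun _ _ => rfl)
  ext x; simp only [Finset.mem_filter, Finset.mem_range, Finset.mem_Ico]; omega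

theorem rowsum_inl (t z : R) (n : ℕ → ℕ) (f x0 : Fin r) (y : ℕ) (hy : y ≤ r) :
    (∑ x : Fin r, if x.val < y then blkC t z n f r (Sum.inl x0) (Sum.inl x) else 0)
      = if x0.val < y then z * t ^ (∑ a ∈ Finset.Ico y r, n a) else 0 := by
  have h1 : ∀ x : Fin r, (if x.val < y then blkC t z n f r (Sum.inl x0) (Sum.inl x) else 0) =
      (if x = x0 then (if x0.val < y then z * t ^ (∑ a ∈ Finset.Ico (x0.val + 1) r, n a) else 0)
        else 0) + z * ((1 - t) * (if x0.val + 1 ≤ x.val ∧ x.val < y then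
          qn t (n x) * t ^ (∑ a ∈ Finset.Ico (x.val + 1) r, n a) else 0)) := by
    intro x
    have := x.2
    have := x0.2
    by_cases hx : x = x0
    · subst hx
      simp [blkC]
    · have hx' : x.val ≠ x0.val := fun h => hx (Fin.ext h)
      simp only [blkC, if_neg hx, if_neg (Ne.symm hx)]
      split_ifs <;> first | omega | simp
      ring
  simp_rw [h1]
  rw [Finset.sum_add_distrib, Finset.sum_ite_eq', ← Finset.mul_sum, ← Finset.mul_sum,
    sum_fin_Ico (fun x => qn t (n x) * t ^ (∑ a ∈ Finset.Ico (x + 1) r, n a)) _ _ hy]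
  simp only [Finset.mem_univ, if_true]
  split_ifs with h
  · rw [telescope t n r _ _ h hy]; ring
  · rw [Finset.Ico_eq_empty (by omega)]; simp

theorem rowsum_inr (t z : R) (n : ℕ → ℕ) (f h : Fin r) (y : ℕ) (hy : y ≤ r) :
    (1 - t) * (∑ x : Fin r, if x.val < y then blkC t z n f r (Sum.inr h) (Sum.inl x) else 0)
      = if h = f then t ^ (∑ a ∈ Finset.Ico y r, n a) - t ^ (∑ a ∈ Finset.Ico 0 r, n a)
        else 0 := by
  by_cases hf : h = f
  · subst hf
    have h1 : ∀ x : Fin r, (if x.val < y then blkC t z n h r (Sum.inr h) (Sum.inl x) else 0) =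
        (if 0 ≤ x.val ∧ x.val < y then
          qn t (n x) * t ^ (∑ a ∈ Finset.Ico (x.val + 1) r, n a) else 0) := by
      intro x; simp [blkC]
    simp_rw [h1]
    rw [sum_fin_Ico (fun x => qn t (n x) * t ^ (∑ a ∈ Finset.Ico (x + 1) r, n a)) _ _ hy,
      telescope t n r _ _ (Nat.zero_le _) hy]
    simp
  · simp [blkC, hf]

theorem mul_blkC_inl (M : Matrix (Spin r) (Spin r) R) (t z : R) (k : ℕ → ℕ) (g : Fin r)
    (x : Spin r) (y : Fin r) :
    (M * blkC t z k g r) x (Sum.inl y) =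
      qn t (k y) * t ^ (∑ a ∈ Finset.Ico (y.val + 1) r, k a) *
        (M x (Sum.inr g) + z * ((1 - t) * ∑ x' : Fin r,
          if x'.val < y.val then M x (Sum.inl x') else 0))
      + z * t ^ (∑ a ∈ Finset.Ico (y.val + 1) r, k a) * M x (Sum.inl y) := by
  rw [Matrix.mul_apply, Fintype.sum_sum_type]
  have h1 : ∀ w : Fin r, M x (Sum.inl w) * blkC t z k g r (Sum.inl w) (Sum.inl y) =
      (if w = y then z * t ^ (∑ a ∈ Finset.Ico (y.val + 1) r, k a) * M x (Sum.inl y) else 0)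
      + (qn t (k y) * t ^ (∑ a ∈ Finset.Ico (y.val + 1) r, k a)) * ((1 - t) * z *
         (if w.val < y.val then M x (Sum.inl w) else 0)) := by
    intro w
    by_cases hw : w = y
    · subst hw; simp [blkC]; ring
    · simp [blkC, hw]; intros; ring
  have h2 : ∀ w : Fin r, M x (Sum.inr w) * blkC t z k g r (Sum.inr w) (Sum.inl y) =
      if w = g then qn t (k y) * t ^ (∑ a ∈ Finset.Ico (y.val + 1) r, k a) * M x (Sum.inr g)
        else 0 := by
    intro w
    by_cases hw : w = g
    · subst hw; simp [blkC]; ring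
    · simp [blkC, hw]
  simp_rw [h1, h2, Finset.sum_add_distrib, Finset.sum_ite_eq', ← Finset.mul_sum]
  simp only [Finset.mem_univ, if_true]
  ring

theorem mul_blkC_inr (M : Matrix (Spin r) (Spin r) R) (t z : R) (k : ℕ → ℕ) (g : Fin r)
    (x : Spin r) (h : Fin r) :
    (M * blkC t z k g r) x (Sum.inr h) =
      if h = g then M x (Sum.inr g) + z * ((1 - t) * ∑ x' : Fin r,
          (if x'.val < r then M x (Sum.inl x') else 0))
      else z * (if h < g then t ^ (∑ a ∈ Finset.Ico 0 r, k a) else 1) * M x (Sum.inr h) := by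
  have hr : 0 < r := g.pos
  rw [Matrix.mul_apply, Fintype.sum_sum_type]
  have h2 : ∀ w : Fin r, M x (Sum.inr w) * blkC t z k g r (Sum.inr w) (Sum.inr h) =
      if w = h then M x (Sum.inr h) * blkC t z k g r (Sum.inr h) (Sum.inr h)
        else 0 := by
    intro w
    by_cases hw : w = h
    · subst hw; simp
    · simp [blkC, hw]
  rw [Finset.sum_congr rfl (fun w _ => h2 w), Finset.sum_ite_eq']
  by_cases hg : h = g
  · subst hg
    simp only [blkC, Fin.is_lt, and_self, if_true, ← Finset.sum_mul, Finset.mem_univ]; ring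
  · simp only [blkC, hg, hr, false_and, if_true, if_false, mul_zero, Finset.sum_const_zero,
      Finset.mem_univ]; ring

def phF (g f : Fin r) (x : Spin r) : Spin r := if x = Sum.inr g then Sum.inr f else x

def Pm (R : Type*) [CommRing R] (g f : Fin r) : Matrix (Spin r) (Spin r) R :=
  fun A a => if phF g f a = A then 1 else 0

theorem mul_Pm (g f : Fin r) (M : Matrix (Spin r) (Spin r) R) (x c : Spin r) :
    (M * Pm R g f) x c = M x (phF g f c) := by
  rw [Matrix.mul_apply]
  simp [Pm]

theorem Pm_mul (g f : Fin r) (hgf : f ≠ g) (M : Matrix (Spin r) (Spin r) R) (A c : Spin r) :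
    (Pm R g f * M) A c = if A = Sum.inr g then 0 else
      M A c + if A = Sum.inr f then M (Sum.inr g) c else 0 := by
  rw [Matrix.mul_apply]
  have h1 : ∀ a, Pm R g f A a * M a c = if A = Sum.inr g then 0 else (if a = A then M A c else 0) +
     (if a = Sum.inr g then (if A = Sum.inr f then M (Sum.inr g) c else 0) else 0) := by
    intro a
    unfold Pm phF
    by_cases h : a = Sum.inr g
    · subst h
      by_cases h2 : A = Sum.inr g
      · subst h2
        simp [hgf]
      · simp [h2, Ne.symm h2, eq_comm]
    · simp only [h, if_false]
      by_cases h2 : A = Sum.inr g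
      · subst h2
        simp [h]
      · by_cases h3 : a = A
        · simp [h3, h2]
        · simp [h3]
  simp_rw [h1]
  by_cases h2 : A = Sum.inr g
  · simp [h2]
  · simp [h2, Finset.sum_add_distrib]

theorem two_block (t z : R) (n k : ℕ → ℕ) (g f : Fin r) (hfg : f.val = g.val + 1) :
    Pm R g f * (blkC t z n f r * blkC t z k g r)
      = z • (blkC t z (fun a => n a + k a) f r * Pm R g f) := by
  have hgf : f ≠ g := fun h => by rw [h] at hfg; omega
  have hr : 0 < r := g.pos
  have hlt : g < f := by rw [Fin.lt_def]; omega
  ext A c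
  rw [Matrix.smul_apply, mul_Pm, Pm_mul _ _ hgf]
  have hT : ∀ y : Fin r, ∑ a ∈ Finset.Ico y.val r, n a
      = n y.val + ∑ a ∈ Finset.Ico (y.val + 1) r, n a :=
    fun y => Finset.sum_eq_sum_Ico_succ_bot y.2 n
  rcases A with x | h
  · simp only [reduceCtorEq, if_false, add_zero]
    rcases c with y | h'
    · have e : phF g f (Sum.inl y) = Sum.inl y := by simp [phF]
      rw [e, mul_blkC_inl, rowsum_inl _ _ _ _ _ _ y.2.le]
      rw [hT y]
      by_cases hxy : x = y
      · subst hxy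
        simp [blkC, hgf, Ne.symm hgf, Finset.sum_add_distrib, pow_add]
        ring
      · have hxy' : x.val ≠ y.val := fun h => hxy (Fin.ext h)
        by_cases hl : x.val < y.val
        · simp [blkC, hgf, Ne.symm hgf, Finset.sum_add_distrib, pow_add, hxy, hl, qn_add]
          ring
        · simp [blkC, hgf, Ne.symm hgf, hxy, hl]
    · rw [mul_blkC_inr, rowsum_inl _ _ _ _ _ _ le_rfl]
      by_cases hg : h' = g
      · subst hg
        simp [phF, blkC, Ne.symm hgf]
      · have e : phF g f (Sum.inr h') = Sum.inr h' := by simp [phF, hg]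
        rw [e]
        by_cases hf : h' = f
        · subst hf
          simp [blkC, hg, not_lt.mpr hlt.le]
        · simp [blkC, hg, hf]
  · by_cases hg : h = g
    · subst hg
      rw [if_pos rfl]
      rcases c with y | h'
      · simp [phF, blkC, Ne.symm hgf]
      · by_cases hg : h' = h
        · subst hg
          simp [phF, blkC, Ne.symm hgf]
        · simp [phF, blkC, hg, Ne.symm hg]
    · rw [if_neg (by simpa using hg)]
      by_cases hf : h = f
      · subst hf
        rw [if_pos rfl]
        rcases c with y | h'
        · have e : phF g h (Sum.inl y) = Sum.inl y := by simp [phF]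
          have q1 := rowsum_inr t z n h h y.val y.2.le
          have q2 := rowsum_inr t z n h g y.val y.2.le
          rw [if_pos rfl, hT y, pow_add] at q1
          rw [if_neg (Ne.symm hgf)] at q2
          rw [e, mul_blkC_inl, mul_blkC_inl, q1, q2]
          simp [blkC, hgf, Ne.symm hgf, Finset.sum_add_distrib, pow_add, qn_add, hr, hlt]
          ring
        · have q1 := rowsum_inr t z n h h r le_rfl
          have q2 := rowsum_inr t z n h g r le_rfl
          rw [if_pos rfl] at q1
          rw [if_neg (Ne.symm hgf)] at q2
          rw [mul_blkC_inr, mul_blkC_inr, q1, q2]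
          by_cases hg' : h' = g
          · subst hg'
            simp [phF, blkC, hgf, Ne.symm hgf, hr, hlt]
            ring
          · have e : phF g h (Sum.inr h') = Sum.inr h' := by simp [phF, hg']
            rw [e]
            by_cases hh : h' = h
            · subst hh
              simp [blkC, hgf, Ne.symm hgf, not_lt.mpr hlt.le]
            · simp [blkC, hg', Ne.symm hg', Ne.symm hh]
      · rw [if_neg (by simpa using hf)]
        rcases c with y | h'
        · have e : phF g f (Sum.inl y) = Sum.inl y := by simp [phF]
          have q1 := rowsum_inr t z n f h y.val y.2.le
          rw [if_neg hf] at q1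
          rw [e, mul_blkC_inl, q1]
          simp [blkC, hg, hf]
        · have q1 := rowsum_inr t z n f h r le_rfl
          rw [if_neg hf] at q1
          rw [mul_blkC_inr, q1]
          by_cases hg' : h' = g
          · subst hg'
            simp [phF, blkC, hg, hf]
          · have e : phF g f (Sum.inr h') = Sum.inr h' := by simp [phF, hg']
            rw [e]
            by_cases hh : h = h'
            · subst hh
              have hh1 : h.val ≠ g.val := fun q => hg (Fin.ext q)
              have hh2 : h.val ≠ f.val := fun q => hf (Fin.ext q)
              have : h < f ↔ h < g := by rw [Fin.lt_def, Fin.lt_def]; omega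
              simp only [blkC, hg, hf, this, hr, if_true, if_false, Finset.sum_add_distrib,
                pow_add, smul_eq_mul]
              split_ifs <;> ring
            · simp [blkC, hg', hh]

end Core2

section Core3
variable {r : ℕ}

def stp {R : Type*} [CommRing R] (t z : R) (b : Fin r × Fin r → ℕ) (v : Fin r × Fin r → R)
    (k : ℕ) : Matrix (Spin r) (Spin r) R :=
  if h : k < r * r then
    stepM t z (b (bosonOfIdx ⟨k, h⟩)) (v (bosonOfIdx ⟨k, h⟩)) (bosonOfIdx ⟨k, h⟩) else 1

theorem bosonOfIdx_block (j a : ℕ) (ha : a < r) (hk : j * r + a < r * r) (f : Fin r)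
    (hf : f.val = r - 1 - j) : bosonOfIdx ⟨j * r + a, hk⟩ = (⟨a, ha⟩, f) := by
  unfold bosonOfIdx
  have hr : 0 < r := by omega
  ext
  · simp [Nat.mod_eq_of_lt ha]
  · simp only [hf]
    rw [mul_comm, Nat.mul_add_div hr, Nat.div_eq_of_lt ha, add_zero]

theorem idx_lt (j a : ℕ) (ha : a < r) (hj : j < r) : j * r + a < r * r := by nlinarith

theorem pass_commute {R : Type*} [CommRing R] (t z : R) (n : ℕ) (v : R) (ab : Fin r × Fin r)
    (g f : Fin r) (hfg : f.val = g.val + 1) (hf : ab.2 ≠ f) (hg : ab.2 ≠ g) :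
    Pm R g f * stepM t z n v ab = stepM t z n v ab * Pm R g f := by
  have hgf : f ≠ g := fun h => by rw [h] at hfg; omega
  ext A c
  rw [mul_Pm, Pm_mul _ _ hgf]
  have hf' : ab.2.val ≠ f.val := fun h => hf (Fin.ext h)
  have hg' : ab.2.val ≠ g.val := fun h => hg (Fin.ext h)
  have hlt : f < ab.2 ↔ g < ab.2 := by rw [Fin.lt_def, Fin.lt_def]; omega
  have hp : passG t z n ab (Sum.inr f) = passG t z n ab (Sum.inr g) := by
    simp [passG, hlt, Ne.symm hf, Ne.symm hg]
  by_cases hA : A = Sum.inr g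
  · subst hA
    rw [if_pos rfl]
    by_cases hc : c = Sum.inr g
    · subst hc
      simp [phF, stepM, hgf]
    · simp [phF, stepM, hc, Ne.symm hg]
  · rw [if_neg hA]
    by_cases hA2 : A = Sum.inr f
    · subst hA2
      rw [if_pos rfl]
      by_cases hc : c = Sum.inr g
      · subst hc
        simp [phF, stepM, hp, hgf, Ne.symm hgf]
      · simp [phF, stepM, hc, Ne.symm hf, Ne.symm hg]
    · rw [if_neg hA2, add_zero]
      by_cases hc : c = Sum.inr g
      · subst hc
        simp [phF, stepM, Ne.symm hf, Ne.symm hg, Ne.symm hA, Ne.symm hA2]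
      · simp [phF, hc]

theorem matProd_diag {ι R : Type*} [Fintype ι] [DecidableEq ι] [CommRing R]
    (d : ℕ → ι → R) (n : ℕ) :
    matProd (fun k => Matrix.diagonal (d k)) n
      = Matrix.diagonal (fun x => ∏ k ∈ Finset.range n, d k x) := by
  induction n with
  | zero => simp [matProd]
  | succ n ih => simp only [matProd]; rw [ih, Matrix.diagonal_mul_diagonal]; simp [Finset.prod_range_succ]

theorem triv_block {R : Type*} [CommRing R] (t z : R) (b : Fin r × Fin r → ℕ)
    (v : Fin r × Fin r → R) (g f : Fin r) (hgf : f ≠ g) (j : ℕ) (hj : j < r)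
    (hg : g.val = r - 1 - j) (hb : ∀ a, b (a, g) = 0) (hv : ∀ a, v (a, g) = 0) :
    matProd (fun a => stp t z b v (j * r + a)) r * Pm R g f = z • Pm R g f := by
  rw [matProd_congr _ (fun a => Matrix.diagonal
    (Sum.elim (fun e => if a = e.val then z else 1)
      (fun h => if h = g then 1 else if a = 0 then z else 1)))]
  · rw [matProd_diag]
    ext x y
    rw [Matrix.diagonal_mul, Matrix.smul_apply, smul_eq_mul]
    rcases x with x | x
    · congr 1
      simp
    · by_cases hx : x = g
      · subst hx
        have : Pm R x f (Sum.inr x) y = 0 := by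
          unfold Pm phF
          by_cases h : y = Sum.inr x
          · subst h; simp [hgf]
          · simp [h]
        simp [this]
      · congr 1
        simp [hx, g.pos.ne']
  · intro a ha
    have hk := idx_lt j a ha hj
    unfold stp
    rw [dif_pos hk, bosonOfIdx_block j a ha hk g hg, hb, hv]
    ext x y
    by_cases hxy : y = x
    · subst hxy
      rw [Matrix.diagonal_apply_eq]
      rcases y with y | y <;> simp [stepM, passG, Fin.ext_iff, eq_comm]
    · rw [Matrix.diagonal_apply_ne _ (Ne.symm hxy)]
      simp [stepM, hxy]

theorem graded_block {K : Type*} [Field K] (t z : K) (b : Fin r × Fin r → ℕ)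
    (v : Fin r × Fin r → K) (f : Fin r) (j : ℕ) (hj : j < r)
    (hf : f.val = r - 1 - j) (w : Fin r → K) (hw : ∀ a, w a ≠ 0) (hv : ∀ a, v (a, f) = w a) :
    matProd (fun a => stp t z b v (j * r + a)) r =
      (∏ a ∈ Finset.range r, if h : a < r then w ⟨a, h⟩ ^ b (⟨a, h⟩, f) else 1) •
      (Matrix.diagonal (Sum.elim w (fun _ => 1)) *
        blkC t z (fun a => if h : a < r then b (⟨a, h⟩, f) else 0) f r *
        Matrix.diagonal (fun x => (Sum.elim w (fun _ => 1) x)⁻¹)) := by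
  have hne : ∀ x : Spin r, Sum.elim w (fun _ => (1:K)) x ≠ 0 := by
    rintro (x | x) <;> simp [hw]
  rw [← blk_eq _ _ _ _ _ le_rfl]
  unfold blk
  rw [← matProd_conj]
  · apply matProd_congr
    intro a ha
    have hk := idx_lt j a ha hj
    unfold stp
    rw [dif_pos hk, bosonOfIdx_block j a ha hk f hf, hv]
    simp only [ha, dif_pos]
    exact stepM_conj t z _ (⟨a, ha⟩, f) w hw
  · rw [Matrix.diagonal_mul_diagonal]
    simp [hne]
  · rw [Matrix.diagonal_mul_diagonal]
    simp [hne]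

theorem core {K : Type*} [Field K] (t z : K) (b b' : Fin r × Fin r → ℕ)
    (v v' : Fin r × Fin r → K) (g f : Fin r) (hfg : f.val = g.val + 1)
    (hv0 : ∀ a, v (a, f) ≠ 0) (hvg : ∀ a, v (a, g) = v (a, f))
    (hv' : ∀ a, v' (a, g) = 0) (hvv : ∀ ab : Fin r × Fin r, ab.2 ≠ g → v' ab = v ab)
    (hb1 : ∀ a, b' (a, f) = b (a, f) + b (a, g)) (hb2 : ∀ a, b' (a, g) = 0)
    (hb3 : ∀ ab : Fin r × Fin r, ab.2 ≠ g → ab.2 ≠ f → b' ab = b ab) :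
    Pm K g f * matProd (stp t z b v) (r * r) = matProd (stp t z b' v') (r * r) * Pm K g f := by
  have hgf : f ≠ g := fun h => by rw [h] at hfg; omega
  have hfr := f.2
  obtain ⟨j, hj⟩ : ∃ j, j = r - 1 - f.val := ⟨_, rfl⟩
  have hj1 : j + 1 < r := by omega
  have hjf : f.val = r - 1 - j := by omega
  have hjg : g.val = r - 1 - (j + 1) := by omega
  obtain ⟨q, hq⟩ : ∃ q, r = j + 2 + q := ⟨r - (j + 2), by omega⟩
  have hrr : r * r = j * r + (r + (r + q * r)) := by
    calc r * r = (j + 2 + q) * r := by rw [← hq]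
      _ = _ := by ring
  -- single steps outside of the two blocks
  have single : ∀ k, (k < j * r ∨ (j + 2) * r ≤ k) →
      Pm K g f * stp t z b v k = stp t z b' v' k * Pm K g f := by
    intro k hk
    unfold stp
    split_ifs with h
    · have hne : (bosonOfIdx ⟨k, h⟩ : Fin r × Fin r).2 ≠ g ∧
          (bosonOfIdx ⟨k, h⟩ : Fin r × Fin r).2 ≠ f := by
        have hr : 0 < r := by omega
        have e1 : (bosonOfIdx ⟨k, h⟩ : Fin r × Fin r).2.val = r - 1 - k / r := rfl
        have e2 : k / r < r := Nat.div_lt_of_lt_mul h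
        have e3 : k / r < j ∨ j + 2 ≤ k / r := by
          rcases hk with hk | hk
          · left; exact Nat.div_lt_of_lt_mul (by rwa [mul_comm])
          · right; exact (Nat.le_div_iff_mul_le hr).2 hk
        constructor
        · intro h; rw [h] at e1; omega
        · intro h; rw [h] at e1; omega
      rw [hb3 _ hne.1 hne.2, hvv _ hne.1]
      exact pass_commute t z _ _ _ g f hfg hne.2 hne.1
    · simp
  rw [hrr]
  simp only [matProd_add]
  have s1 : ∀ c : ℕ → Matrix (Spin r) (Spin r) K,
      (fun k => c (j * r + (r + k))) = fun k => c ((j + 1) * r + k) := by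
    intro c; funext k; congr 1; ring
  rw [← Matrix.mul_assoc, matProd_intertwine _ _ (stp t z b' v') _
    (fun k hk => single k (Or.inl hk)), Matrix.mul_assoc, Matrix.mul_assoc]
  congr 1
  have hlast : Pm K g f * matProd (fun k => stp t z b v (j * r + (r + (r + k)))) (q * r)
      = matProd (fun k => stp t z b' v' (j * r + (r + (r + k)))) (q * r) * Pm K g f := by
    apply matProd_intertwine
    intro k _
    apply single
    right
    have : (j + 2) * r = j * r + (r + r) := by ring
    omega
  have htwo : Pm K g f * (matProd (fun k => stp t z b v (j * r + k)) r *
        matProd (fun k => stp t z b v (j * r + (r + k))) r)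
      = matProd (fun k => stp t z b' v' (j * r + k)) r *
        matProd (fun k => stp t z b' v' (j * r + (r + k))) r * Pm K g f := by
    rw [s1 (stp t z b v), s1 (stp t z b' v'), Matrix.mul_assoc,
      triv_block t z b' v' g f hgf (j + 1) hj1 hjg hb2 hv',
      graded_block t z b v f j (by omega) hjf (fun a => v (a, f)) hv0 (fun _ => rfl),
      graded_block t z b v g (j + 1) hj1 hjg (fun a => v (a, f)) hv0 hvg,
      graded_block t z b' v' f j (by omega) hjf (fun a => v (a, f)) hv0
        (fun a => hvv (a, f) hgf)]
    set U : Matrix (Spin r) (Spin r) K := Matrix.diagonal (Sum.elim (fun a => v (a, f)) (fun _ => 1))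
    set U' : Matrix (Spin r) (Spin r) K :=
      Matrix.diagonal (fun x => (Sum.elim (fun a => v (a, f)) (fun _ => 1) x)⁻¹)
    have hne : ∀ x : Spin r, Sum.elim (fun a => v (a, f)) (fun _ => (1:K)) x ≠ 0 := by
      rintro (x | x) <;> simp [hv0]
    have hUU : U' * U = 1 := by
      simp only [U, U', Matrix.diagonal_mul_diagonal]
      simp [hne]
    have hPU : Pm K g f * U = U * Pm K g f := by
      ext x y
      simp only [U, Matrix.diagonal_mul, Matrix.mul_diagonal]
      unfold Pm phF
      rcases y with y | y
      · by_cases h : (Sum.inl y : Spin r) = x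
        · subst h; simp
        · simp [h]
      · rcases x with x | x
        · by_cases hy : y = g <;> simp [hy]
        · simp
    have hPU' : Pm K g f * U' = U' * Pm K g f := by
      ext x y
      simp only [U', Matrix.diagonal_mul, Matrix.mul_diagonal]
      unfold Pm phF
      rcases y with y | y
      · by_cases h : (Sum.inl y : Spin r) = x
        · subst h; simp
        · simp [h]
      · rcases x with x | x
        · by_cases hy : y = g <;> simp [hy]
        · simp
    have hn : (fun a => if h : a < r then b' (⟨a, h⟩, f) else 0) =
        fun a => (fun a => if h : a < r then b (⟨a, h⟩, f) else 0) a +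
          (fun a => if h : a < r then b (⟨a, h⟩, g) else 0) a := by
      funext a
      by_cases h : a < r <;> simp [h, hb1]
    rw [hn]
    have htb := two_block t z (fun a => if h : a < r then b (⟨a, h⟩, f) else 0)
      (fun a => if h : a < r then b (⟨a, h⟩, g) else 0) g f hfg
    set X := blkC t z (fun a => if h : a < r then b (⟨a, h⟩, f) else 0) f r
    set Y := blkC t z (fun a => if h : a < r then b (⟨a, h⟩, g) else 0) g r
    set Z := blkC t z (fun a => (fun a => if h : a < r then b (⟨a, h⟩, f) else 0) a +
          (fun a => if h : a < r then b (⟨a, h⟩, g) else 0) a) f r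
    have hc : (∏ a ∈ Finset.range r, if h : a < r then v (⟨a, h⟩, f) ^ b' (⟨a, h⟩, f) else 1)
      = (∏ a ∈ Finset.range r, if h : a < r then v (⟨a, h⟩, f) ^ b (⟨a, h⟩, f) else 1) *
        (∏ a ∈ Finset.range r, if h : a < r then v (⟨a, h⟩, f) ^ b (⟨a, h⟩, g) else 1) := by
      rw [← Finset.prod_mul_distrib]
      apply Finset.prod_congr rfl
      intro a ha
      have ha := Finset.mem_range.1 ha
      simp [ha, hb1, pow_add]
    rw [hc]
    simp only [Matrix.smul_mul, Matrix.mul_smul, smul_smul]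
    have e1 : Pm K g f * (U * X * U' * (U * Y * U')) = z • (U * Z * U' * Pm K g f) := by
      calc Pm K g f * (U * X * U' * (U * Y * U'))
          = (Pm K g f * U) * X * (U' * U) * Y * U' := by simp only [Matrix.mul_assoc]
        _ = U * (Pm K g f * (X * Y)) * U' := by
            rw [hUU, hPU, Matrix.mul_one]; simp only [Matrix.mul_assoc]
        _ = z • (U * Z * (Pm K g f * U')) := by
            rw [htb]; simp only [Matrix.smul_mul, Matrix.mul_smul, Matrix.mul_assoc]
        _ = _ := by rw [hPU']; simp only [Matrix.mul_assoc]
    rw [e1, smul_smul]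
    congr 1
    ring
  calc _ = Pm K g f * (matProd (fun k => stp t z b v (j * r + k)) r *
        matProd (fun k => stp t z b v (j * r + (r + k))) r) *
        matProd (fun k => stp t z b v (j * r + (r + (r + k)))) (q * r) := by
          simp only [Matrix.mul_assoc]
    _ = _ := by rw [htwo, Matrix.mul_assoc _ (Pm K g f), hlast]; simp only [Matrix.mul_assoc]

end Core3

section Coeff
variable {r : ℕ}

open Classical in
/-- Numeric step matrices with both multiplicities fixed. -/
noncomputable def numStep (zi : PolyR r) (m m' : ℕ) (ab : Fin r × Fin r) :
    Matrix (Spin r) (Spin r) (PolyR r) :=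
  fun x y => if StepOK (fun _ => m) (fun _ => m') ab x y then stepWeight zi m m' ab x else 0

noncomputable def numStp (zi : PolyR r) (m m' : Fin r × Fin r → ℕ) (k : ℕ) :
    Matrix (Spin r) (Spin r) (PolyR r) :=
  if h : k < r * r then
    numStep zi (m (bosonOfIdx ⟨k, h⟩)) (m' (bosonOfIdx ⟨k, h⟩)) (bosonOfIdx ⟨k, h⟩) else 1

theorem StepOK_next (m m' : Fin r × Fin r → ℕ) (ab : Fin r × Fin r) (x y : Spin r)
    (h : StepOK m m' ab x y) : y = nextSpin m m' ab x := by
  unfold nextSpin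
  rcases h with ⟨h1, h2⟩ | ⟨h1, h2, h3⟩ | ⟨h1, h2, h3⟩
  · rw [if_neg (by omega), if_neg (by omega), h1]
  · rw [if_pos h3, h2]
  · rw [if_neg (by omega), if_pos h3, h2]

open Classical in
theorem numProd_apply (zi : PolyR r) (m m' : Fin r × Fin r → ℕ) (l y : Spin r) (n : ℕ)
    (hn : n ≤ r * r) :
    matProd (numStp zi m m') n l y =
      if (∀ k (h : k < r * r), k < n → StepOK m m' (bosonOfIdx ⟨k, h⟩) (pathSpin m m' l k)
          (pathSpin m m' l (k + 1))) ∧ pathSpin m m' l n = y then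
        ∏ k ∈ Finset.range n, (if h : k < r * r then
          stepWeight zi (m (bosonOfIdx ⟨k, h⟩)) (m' (bosonOfIdx ⟨k, h⟩)) (bosonOfIdx ⟨k, h⟩)
            (pathSpin m m' l k) else 1) else 0 := by
  induction n generalizing y with
  | zero => simp [matProd, pathSpin, Matrix.one_apply]
  | succ n ih =>
    have hn' : n < r * r := hn
    have hS : ∀ x y, numStp zi m m' n x y = if StepOK m m' (bosonOfIdx ⟨n, hn'⟩) x y then
        stepWeight zi (m (bosonOfIdx ⟨n, hn'⟩)) (m' (bosonOfIdx ⟨n, hn'⟩)) (bosonOfIdx ⟨n, hn'⟩) x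
        else 0 := by
      intro x y; unfold numStp; rw [dif_pos hn']; rfl
    have hp : pathSpin m m' l (n + 1) =
        nextSpin m m' (bosonOfIdx ⟨n, hn'⟩) (pathSpin m m' l n) := by
      rw [pathSpin, dif_pos hn']
    rw [matProd, Matrix.mul_apply, Finset.sum_eq_single (pathSpin m m' l n)]
    · rw [ih _ (by omega), hS, Finset.prod_range_succ, dif_pos hn']
      by_cases h1 : ∀ k (h : k < r * r), k < n → StepOK m m' (bosonOfIdx ⟨k, h⟩)
          (pathSpin m m' l k) (pathSpin m m' l (k + 1))
      · rw [if_pos ⟨h1, rfl⟩]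
        by_cases h2 : StepOK m m' (bosonOfIdx ⟨n, hn'⟩) (pathSpin m m' l n) y
        · have hy := StepOK_next _ _ _ _ _ h2
          rw [if_pos h2, if_pos]
          refine ⟨fun k h hk => ?_, by rw [hp, hy]⟩
          rcases Nat.lt_succ_iff_lt_or_eq.1 hk with hk | hk
          · exact h1 k h hk
          · subst hk
            rw [hp, ← hy]; exact h2
        · rw [if_neg h2, if_neg, mul_zero]
          rintro ⟨h3, h4⟩
          apply h2
          rw [← h4]
          exact h3 n hn' (by omega)
      · rw [if_neg (fun h => h1 h.1), zero_mul, if_neg]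
        rintro ⟨h3, -⟩
        exact h1 (fun k h hk => h3 k h (by omega))
    · intro x _ hx
      rw [ih _ (by omega), if_neg (fun h => hx h.2.symm), zero_mul]
    · simp

theorem adm_iff (m m' : Fin r × Fin r → ℕ) (l y : Spin r) :
    AdmissibleVertex l m y m' ↔
      (∀ k (h : k < r * r), k < r * r → StepOK m m' (bosonOfIdx ⟨k, h⟩) (pathSpin m m' l k)
          (pathSpin m m' l (k + 1))) ∧ pathSpin m m' l (r * r) = y := by
  constructor
  · rintro ⟨x, h0, hl, hs⟩
    have hx : ∀ k (h : k < r * r + 1), x ⟨k, h⟩ = pathSpin m m' l k := by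
      intro k
      induction k with
      | zero => intro h; rw [pathSpin]; exact h0
      | succ k ih =>
        intro h
        have hk : k < r * r := by omega
        have := StepOK_next _ _ _ _ _ (hs ⟨k, hk⟩)
        rw [pathSpin, dif_pos hk, ← ih (by omega)]
        exact this
    refine ⟨fun k h _ => ?_, ?_⟩
    · rw [← hx k (by omega), ← hx (k + 1) (by omega)]
      exact hs ⟨k, h⟩
    · rw [← hx _ (by omega), ← hl]; rfl
  · rintro ⟨h1, h2⟩
    exact ⟨fun k => pathSpin m m' l k.val, rfl, h2, fun k => h1 k.val k.2 k.2⟩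

theorem numProd_eq_Wvert (zi : PolyR r) (m m' : Fin r × Fin r → ℕ) (l y : Spin r) :
    matProd (numStp zi m m') (r * r) l y = Wvert zi l m y m' := by
  rw [numProd_apply _ _ _ _ _ _ le_rfl]
  unfold Wvert
  by_cases h : AdmissibleVertex l m y m'
  · rw [if_pos h, if_pos ((adm_iff _ _ _ _).1 h), vertexWeight, Finset.prod_range]
    apply Finset.prod_congr rfl
    intro k _
    rw [dif_pos k.2]
  · rw [if_neg h, if_neg (fun h' => h ((adm_iff _ _ _ _).2 h'))]

/-- The polynomial ring of bookkeeping variables. -/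
abbrev QR (r : ℕ) := MvPolynomial (Fin r × Fin r) (PolyR r)

theorem passG_C (zi : PolyR r) (n : ℕ) (ab : Fin r × Fin r) (x : Spin r) :
    passG (MvPolynomial.C (tP r) : QR r) (MvPolynomial.C zi) n ab x
      = MvPolynomial.C (passWeight zi n ab x) := by
  unfold passG passWeight
  rcases x with x | x <;> simp only [] <;> split_ifs <;> simp

theorem stepM_expand (zi : PolyR r) (n : ℕ) (ab : Fin r × Fin r) (x y : Spin r) :
    stepM (MvPolynomial.C (tP r) : QR r) (MvPolynomial.C zi) n (MvPolynomial.X ab) ab x y =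
      ∑ j ∈ Finset.range (n + 2),
        MvPolynomial.monomial (Finsupp.single ab j) (numStep zi n j ab x y) := by
  have mono : ∀ (j : ℕ) (c : PolyR r), (MvPolynomial.monomial (Finsupp.single ab j) c : QR r)
      = MvPolynomial.C c * MvPolynomial.X ab ^ j := fun j c => by
    rw [MvPolynomial.C_mul_X_pow_eq_monomial]
  unfold stepM
  by_cases h1 : y = x
  · subst h1
    rw [if_pos rfl, Finset.sum_eq_single n]
    · rw [mono, passG_C]
      simp [numStep, StepOK, stepWeight]
    · intro j _ hj
      have : numStep zi n j ab y y = 0 := by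
        unfold numStep StepOK
        rw [if_neg]
        rintro (⟨-, h⟩ | ⟨h, h', -⟩ | ⟨h, h', -⟩)
        · exact hj h
        · rw [h] at h'; simp at h'
        · rw [h] at h'; simp at h'
      rw [this, map_zero]
    · intro h; exact absurd (Finset.mem_range.2 (by omega)) h
  · rw [if_neg h1]
    by_cases h2 : x = Sum.inr ab.2 ∧ y = Sum.inl ab.1
    · obtain ⟨hx, hy⟩ := h2
      subst hx; subst hy
      rw [if_pos ⟨rfl, rfl⟩]
      have hs : ∀ j, numStep zi n j ab (Sum.inr ab.2) (Sum.inl ab.1) =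
          if n = j + 1 then ∑ i ∈ Finset.range n, tP r ^ i else 0 := by
        intro j
        by_cases hj : n = j + 1
        · subst hj
          simp [numStep, StepOK, stepWeight]
        · simp [numStep, StepOK, hj]
      rcases n with _ | n
      · simp [hs]
      · rw [Finset.sum_eq_single (s := Finset.range (n + 1 + 2)) n]
        · rw [mono, hs]; simp
        · intro j _ hj
          rw [hs, if_neg (by omega), map_zero]
        · intro h; exact absurd (Finset.mem_range.2 (by omega)) h
    · rw [if_neg h2]
      by_cases h3 : x = Sum.inl ab.1 ∧ y = Sum.inr ab.2
      · obtain ⟨hx, hy⟩ := h3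
        subst hx; subst hy
        rw [if_pos ⟨rfl, rfl⟩]
        rw [Finset.sum_eq_single (n + 1)]
        · rw [mono]
          have h0 : ¬ (n = n + 1 + 1) := by omega
          simp only [numStep, StepOK, stepWeight, h0, and_self, or_true, if_true, if_false]
          simp [mul_assoc]
        · intro j _ hj
          have : numStep zi n j ab (Sum.inl ab.1) (Sum.inr ab.2) = 0 := by
            simp [numStep, StepOK, hj]
          rw [this, map_zero]
        · intro h; exact absurd (Finset.mem_range.2 (by omega)) h
      · rw [if_neg h3]
        symm
        apply Finset.sum_eq_zero
        intro j _
        have : numStep zi n j ab x y = 0 := by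
          unfold numStep StepOK
          rw [if_neg]
          rintro (⟨h, -⟩ | ⟨h, h', -⟩ | ⟨h, h', -⟩)
          · exact h1 h
          · exact h2 ⟨h, h'⟩
          · exact h3 ⟨h, h'⟩
        rw [this, map_zero]

theorem numStep_zero (zi : PolyR r) (n j : ℕ) (ab : Fin r × Fin r) (x y : Spin r)
    (h : n + 2 ≤ j) : numStep zi n j ab x y = 0 := by
  unfold numStep StepOK
  rw [if_neg]
  rintro (⟨-, h⟩ | ⟨-, -, h⟩ | ⟨-, -, h⟩) <;> dsimp only at h <;> omega

theorem bosonOfIdx_inj (k k' : Fin (r * r)) (h : bosonOfIdx k = bosonOfIdx k') : k = k' := by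
  have h1 : k.val % r = k'.val % r := congrArg (fun p => p.1.val) h
  have h2 : r - 1 - k.val / r = r - 1 - k'.val / r := congrArg (fun p => p.2.val) h
  have e1 : k.val / r < r := Nat.div_lt_of_lt_mul k.2
  have e2 : k'.val / r < r := Nat.div_lt_of_lt_mul k'.2
  have h3 : k.val / r = k'.val / r := by omega
  apply Fin.ext
  rw [← Nat.div_add_mod k.val r, ← Nat.div_add_mod k'.val r, h1, h3]

noncomputable def ZQ (zi : PolyR r) (m : Fin r × Fin r → ℕ) (n : ℕ) :
    Matrix (Spin r) (Spin r) (QR r) :=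
  matProd (stp (MvPolynomial.C (tP r) : QR r) (MvPolynomial.C zi) m MvPolynomial.X) n

open Classical in
theorem coeff_ZQ_aux (zi : PolyR r) (m : Fin r × Fin r → ℕ) (l y : Spin r) (n : ℕ)
    (hn : n ≤ r * r) (δ : Fin r × Fin r →₀ ℕ) :
    MvPolynomial.coeff δ (ZQ zi m n l y) =
      if (∀ k (h : k < r * r), n ≤ k → δ (bosonOfIdx ⟨k, h⟩) = 0) ∧
          (∀ ab, (∃ k, bosonOfIdx k = ab) ∨ δ ab = 0) then
        matProd (numStp zi m δ) n l y else 0 := by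
  induction n generalizing y δ with
  | zero =>
    have hiff : ((∀ k (h : k < r * r), 0 ≤ k → δ (bosonOfIdx ⟨k, h⟩) = 0) ∧
          (∀ ab, (∃ k, bosonOfIdx k = ab) ∨ δ ab = 0)) ↔ 0 = δ := by
      constructor
      · rintro ⟨h1, h2⟩
        ext ab
        rcases h2 ab with ⟨k, hk⟩ | h
        · rw [← hk]; exact (h1 k.val k.2 (Nat.zero_le _)).symm
        · exact h.symm
      · rintro rfl; simp
    rw [if_congr hiff rfl rfl]
    simp only [ZQ, matProd, Matrix.one_apply]
    by_cases h : l = y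
    · simp [h, MvPolynomial.coeff_one]
    · simp [h]
  | succ n ih =>
    have hn' : n < r * r := hn
    set ab := bosonOfIdx ⟨n, hn'⟩ with hab
    have hZ : ZQ zi m (n + 1) l y = ∑ x, ∑ j ∈ Finset.range (m ab + 2),
        ZQ zi m n l x * MvPolynomial.monomial (Finsupp.single ab j)
          (numStep zi (m ab) j ab x y) := by
      unfold ZQ
      rw [matProd, Matrix.mul_apply]
      apply Finset.sum_congr rfl
      intro x _
      rw [← Finset.mul_sum, ← stepM_expand]
      simp only [stp, dif_pos hn']
      rfl
    rw [hZ, MvPolynomial.coeff_sum]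
    have hx : ∀ x, MvPolynomial.coeff δ (∑ j ∈ Finset.range (m ab + 2),
        ZQ zi m n l x * MvPolynomial.monomial (Finsupp.single ab j)
          (numStep zi (m ab) j ab x y)) =
        if (∀ k (h : k < r * r), n + 1 ≤ k → δ (bosonOfIdx ⟨k, h⟩) = 0) ∧
          (∀ ab, (∃ k, bosonOfIdx k = ab) ∨ δ ab = 0) then
          matProd (numStp zi m δ) n l x * numStep zi (m ab) (δ ab) ab x y else 0 := by
      intro x
      rw [MvPolynomial.coeff_sum]
      simp_rw [MvPolynomial.coeff_mul_monomial', Finsupp.single_le_iff, ih _ (by omega : n ≤ r * r)]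
      have hsub : ∀ j p, (δ - Finsupp.single ab j) p = if p = ab then δ ab - j else δ p := by
        intro j p
        rw [Finsupp.tsub_apply]
        by_cases hp : p = ab
        · subst hp; simp
        · rw [Finsupp.single_eq_of_ne hp, if_neg hp]; rfl
      have hoff : ∀ k (h : k < r * r), k ≠ n → bosonOfIdx ⟨k, h⟩ ≠ ab := by
        intro k h hk hh
        have := bosonOfIdx_inj _ _ hh
        exact hk (by simpa using this)
      have main : ∀ j, (if j ≤ δ ab then
          (if (∀ k (h : k < r * r), n ≤ k → (δ - Finsupp.single ab j) (bosonOfIdx ⟨k, h⟩) = 0) ∧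
            (∀ ab', (∃ k, bosonOfIdx k = ab') ∨ (δ - Finsupp.single ab j) ab' = 0) then
            matProd (numStp zi m ⇑(δ - Finsupp.single ab j)) n l x else 0) *
              numStep zi (m ab) j ab x y else 0) =
          if j = δ ab then
            (if (∀ k (h : k < r * r), n + 1 ≤ k → δ (bosonOfIdx ⟨k, h⟩) = 0) ∧
              (∀ ab, (∃ k, bosonOfIdx k = ab) ∨ δ ab = 0) then
              matProd (numStp zi m δ) n l x * numStep zi (m ab) (δ ab) ab x y else 0) else 0 := by
        intro j
        rcases lt_trichotomy j (δ ab) with hj | hj | hj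
        · rw [if_pos hj.le, if_neg hj.ne, if_neg, zero_mul]
          rintro ⟨h1, -⟩
          have := h1 n hn' le_rfl
          rw [hsub, if_pos rfl] at this
          omega
        · rw [if_pos hj.le, if_pos hj]
          have hcongr : matProd (numStp zi m ⇑(δ - Finsupp.single ab j)) n
              = matProd (numStp zi m δ) n := by
            apply matProd_congr
            intro k hk
            have hk' : k < r * r := by omega
            unfold numStp
            rw [dif_pos hk', dif_pos hk', hsub, if_neg (hoff k hk' (by omega))]
          have hiff : ((∀ k (h : k < r * r), n ≤ k →
                (δ - Finsupp.single ab j) (bosonOfIdx ⟨k, h⟩) = 0) ∧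
              (∀ ab', (∃ k, bosonOfIdx k = ab') ∨ (δ - Finsupp.single ab j) ab' = 0)) ↔
              ((∀ k (h : k < r * r), n + 1 ≤ k → δ (bosonOfIdx ⟨k, h⟩) = 0) ∧
              (∀ ab, (∃ k, bosonOfIdx k = ab) ∨ δ ab = 0)) := by
            constructor
            · rintro ⟨h1, h2⟩
              refine ⟨fun k h hk => ?_, fun ab' => ?_⟩
              · have := h1 k h (by omega)
                rwa [hsub, if_neg (hoff k h (by omega))] at this
              · by_cases hp : ab' = ab
                · left; exact ⟨_, hp.symm⟩
                · have := h2 ab'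
                  rwa [hsub, if_neg hp] at this
            · rintro ⟨h1, h2⟩
              refine ⟨fun k h hk => ?_, fun ab' => ?_⟩
              · rw [hsub]
                by_cases hk' : k = n
                · subst hk'; rw [if_pos rfl]; omega
                · rw [if_neg (hoff k h hk')]; exact h1 k h (by omega)
              · by_cases hp : ab' = ab
                · left; exact ⟨_, hp.symm⟩
                · rw [hsub, if_neg hp]; exact h2 ab'
          rw [if_congr hiff rfl rfl, hcongr, ite_mul, zero_mul, hj]
        · rw [if_neg (by omega), if_neg (by omega)]
      rw [Finset.sum_congr rfl (fun j _ => main j), Finset.sum_ite_eq']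
      by_cases hd : δ ab ∈ Finset.range (m ab + 2)
      · rw [if_pos hd]
      · rw [if_neg hd, numStep_zero _ _ _ _ _ _ (by simpa using hd)]
        simp
    rw [Finset.sum_congr rfl (fun x _ => hx x), matProd, Matrix.mul_apply]
    by_cases hc : (∀ k (h : k < r * r), n + 1 ≤ k → δ (bosonOfIdx ⟨k, h⟩) = 0) ∧
          (∀ ab, (∃ k, bosonOfIdx k = ab) ∨ δ ab = 0)
    · simp only [if_pos hc]
      apply Finset.sum_congr rfl
      intro x _
      congr 1
      unfold numStp
      rw [dif_pos hn']
    · simp only [if_neg hc]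
      simp

theorem bosonOfIdx_surj (ab : Fin r × Fin r) : ∃ k : Fin (r * r), bosonOfIdx k = ab := by
  have h1 := ab.1.2
  have h2 := ab.2.2
  have hk := idx_lt (r := r) (r - 1 - ab.2.val) ab.1.val h1 (by omega)
  exact ⟨⟨_, hk⟩, bosonOfIdx_block _ _ h1 hk ab.2 (by omega)⟩

theorem coeff_ZQ (zi : PolyR r) (m : Fin r × Fin r → ℕ) (l y : Spin r)
    (δ : Fin r × Fin r →₀ ℕ) :
    MvPolynomial.coeff δ (ZQ zi m (r * r) l y) = Wvert zi l m y δ := by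
  rw [coeff_ZQ_aux _ _ _ _ _ le_rfl, if_pos, numProd_eq_Wvert]
  exact ⟨fun k h h' => by omega, fun ab => Or.inl (bosonOfIdx_surj ab)⟩

end Coeff

section Final
variable {r : ℕ}

open Classical in
theorem coeff_rename_gen {σ τ S : Type*} [CommRing S] (π : σ → τ) (p : MvPolynomial σ S)
    (D : τ →₀ ℕ) :
    MvPolynomial.coeff D (MvPolynomial.rename π p) =
      ∑ d ∈ p.support, if Finsupp.mapDomain π d = D then MvPolynomial.coeff d p else 0 := by
  conv_lhs => rw [p.as_sum]
  rw [map_sum, MvPolynomial.coeff_sum]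
  apply Finset.sum_congr rfl
  intro d _
  rw [MvPolynomial.rename_monomial, MvPolynomial.coeff_monomial]

open Classical in
theorem coeff_kill {σ S : Type*} [CommRing S] (B : σ → Prop) (p : MvPolynomial σ S)
    (D : σ →₀ ℕ) (hD : ∀ s, B s → D s = 0) :
    MvPolynomial.coeff D (MvPolynomial.bind₁
      (fun s => if B s then (0 : MvPolynomial σ S) else MvPolynomial.X s) p)
      = MvPolynomial.coeff D p := by
  conv_lhs => rw [p.as_sum]
  conv_rhs => rw [p.as_sum]
  rw [map_sum, MvPolynomial.coeff_sum, MvPolynomial.coeff_sum]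
  apply Finset.sum_congr rfl
  intro d _
  rw [MvPolynomial.bind₁_monomial]
  by_cases h : ∃ s ∈ d.support, B s
  · obtain ⟨s, hs, hB⟩ := h
    rw [Finset.prod_eq_zero hs, mul_zero, MvPolynomial.coeff_zero, MvPolynomial.coeff_monomial,
      if_neg]
    · intro h
      rw [h] at hs
      exact (Finsupp.mem_support_iff.1 hs) (hD s hB)
    · rw [if_pos hB, zero_pow (Finsupp.mem_support_iff.1 hs)]
  · push Not at h
    congr 1
    rw [MvPolynomial.monomial_eq, Finsupp.prod]
    congr 1
    apply Finset.prod_congr rfl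
    intro s hs
    rw [if_neg (h s hs)]

theorem stp_map {R S : Type*} [CommRing R] [CommRing S] (φ : R →+* S) (t z : R)
    (b : Fin r × Fin r → ℕ) (v : Fin r × Fin r → R) (k : ℕ) :
    (stp t z b v k).map φ = stp (φ t) (φ z) b (fun ab => φ (v ab)) k := by
  unfold stp
  split_ifs
  · exact stepM_map φ _ _ _ _ _
  · exact Matrix.map_one φ (map_zero _) (map_one _)

theorem Zmap {R S : Type*} [CommRing R] [CommRing S] (φ : R →+* S) (t z : R)
    (b : Fin r × Fin r → ℕ) (v : Fin r × Fin r → R) (n : ℕ) (x y : Spin r) :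
    φ (matProd (stp t z b v) n x y) =
      matProd (stp (φ t) (φ z) b (fun ab => φ (v ab))) n x y := by
  have := congrFun (congrFun (matProd_map φ (stp t z b v) n) x) y
  rw [Matrix.map_apply] at this
  rw [this]
  congr 2
  funext k
  exact stp_map φ t z b v k

/-- The intertwining relation in the polynomial ring. -/
theorem core_poly (zi : PolyR r) (b b' : Fin r × Fin r → ℕ) (g f : Fin r)
    (hfg : f.val = g.val + 1)
    (hb1 : ∀ a, b' (a, f) = b (a, f) + b (a, g)) (hb2 : ∀ a, b' (a, g) = 0)
    (hb3 : ∀ ab : Fin r × Fin r, ab.2 ≠ g → ab.2 ≠ f → b' ab = b ab)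
    (v v' : Fin r × Fin r → QR r)
    (hv : ∀ ab, v ab = MvPolynomial.X (if ab.2 = g then (ab.1, f) else ab))
    (hv' : ∀ ab, v' ab = if ab.2 = g then 0 else MvPolynomial.X ab) :
    Pm (QR r) g f * matProd (stp (MvPolynomial.C (tP r) : QR r) (MvPolynomial.C zi) b v) (r * r)
      = matProd (stp (MvPolynomial.C (tP r) : QR r) (MvPolynomial.C zi) b' v') (r * r)
        * Pm (QR r) g f := by
  have hgf : f ≠ g := fun h => by rw [h] at hfg; omega
  set φ := algebraMap (QR r) (FractionRing (QR r))
  have hinj : Function.Injective φ := IsFractionRing.injective _ _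
  have key := core (φ (MvPolynomial.C (tP r))) (φ (MvPolynomial.C zi)) b b'
    (fun ab => φ (v ab)) (fun ab => φ (v' ab)) g f hfg
    (fun a => by
      rw [hv, Ne, map_eq_zero_iff φ hinj]; exact MvPolynomial.X_ne_zero _)
    (fun a => by simp [hv, hgf])
    (fun a => by simp [hv'])
    (fun ab h => by simp [hv, hv', h]) hb1 hb2 hb3
  ext1 A c
  apply hinj
  have := congrFun (congrFun key A) c
  rw [mul_Pm, Pm_mul _ _ hgf] at this ⊢
  rw [← Zmap, ← Zmap, ← Zmap] at this
  rw [← this]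
  split_ifs <;> simp

end Final

open Classical in
/-- color merging for a single vertex. Merging the dolor `d_e` into `d_{e+1}`
via `p_h` (on spins) and `p_v` (on multiplicity functions) preserves vertex weights:
`W(A, p_v(b), p_h(c), D) = Σ_{a : p_h(a)=A} Σ_{d : p_v(d)=D} W(a,b,c,d)`. -/
theorem stmt14 (r N : ℕ) (hr : 1 ≤ r) (hN : 1 ≤ N)
    (e : ℕ) (he1 : 1 ≤ e) (he2 : e ≤ r - 1) (i : Fin r) :
    let de : Fin r := ⟨e - 1, by omega⟩       -- the dolor `d_e`
    let de' : Fin r := ⟨e, by omega⟩          -- the dolor `d_{e+1}`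
    let ph : Spin r → Spin r := fun x => if x = Sum.inr de then Sum.inr de' else x
    let pv : (Fin r × Fin r → ℕ) → (Fin r × Fin r → ℕ) := fun m ab =>
      if ab.2 = de' then m (ab.1, de) + m (ab.1, de')
      else if ab.2 = de then 0
      else m ab
    ∀ (A : Spin r), A ≠ Sum.inr de →
    ∀ (D : Fin r × Fin r → ℕ), (∀ a : Fin r, D (a, de) = 0) →
    ∀ (b : Fin r × Fin r → ℕ) (c : Spin r),
      Wvert (zP i) A (pv b) (ph c) D =
        ∑ a : Spin r,
          (if ph a = A then
            (finsum fun d : Fin r × Fin r → ℕ =>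
              if pv d = D then Wvert (zP i) a b c d else 0)
          else 0) := by
  intro de de' ph pv A hA D hD b c
  have hfg : de'.val = de.val + 1 := by simp only [de, de']; omega
  have hgf : de' ≠ de := fun h => by rw [h] at hfg; omega
  have hph : ∀ x, ph x = phF de de' x := by
    intro x; simp only [ph, phF]
  set π : Fin r × Fin r → Fin r × Fin r := fun ab => if ab.2 = de then (ab.1, de') else ab with hπ
  have hfiber : ∀ (d : Fin r × Fin r →₀ ℕ) (x : Fin r × Fin r), Finsupp.mapDomain π d x = pv d x := by
    intro d x
    rw [Finsupp.mapDomain, Finsupp.sum_fintype _ _ (by simp), Finsupp.finset_sum_apply]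
    simp only [Finsupp.single_apply]
    by_cases h1 : x.2 = de'
    · have hs : ∀ y, (if π y = x then d y else 0) =
          (if y = (x.1, de) then d y else 0) + (if y = (x.1, de') then d y else 0) := by
        rintro ⟨y1, y2⟩
        obtain ⟨x1, x2⟩ := x
        dsimp only at h1
        subst h1
        by_cases hy : y2 = de
        · subst hy
          simp [π, Ne.symm hgf]
        · simp [π, hy]
      simp_rw [hs, Finset.sum_add_distrib, Finset.sum_ite_eq']
      simp [pv, h1]
    · by_cases h2 : x.2 = de
      · have : pv d x = 0 := by simp only [pv]; rw [if_neg h1, if_pos h2]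
        rw [this]
        apply Finset.sum_eq_zero
        intro y _
        rw [if_neg]
        intro hy
        simp only [π] at hy
        split_ifs at hy with h3
        · rw [← hy] at h1; exact h1 rfl
        · rw [hy] at h3; exact h3 h2
      · have : pv d x = d x := by simp only [pv]; rw [if_neg h1, if_neg h2]
        rw [this, Finset.sum_eq_single x]
        · simp [π, h2]
        · intro y _ hy
          rw [if_neg]
          intro hy'
          simp only [π] at hy'
          split_ifs at hy' with h3
          · rw [← hy'] at h1; exact h1 rfl
          · exact hy hy'
        · simp
  set D' : Fin r × Fin r →₀ ℕ := Finsupp.equivFunOnFinite.symm D with hD'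
  have hDD : ⇑D' = D := by simp [hD']
  have hinner : ∀ a, (finsum fun d : Fin r × Fin r → ℕ =>
      if pv d = D then Wvert (zP i) a b c d else 0) =
      MvPolynomial.coeff D' (MvPolynomial.rename π (ZQ (zP i) b (r * r) a c)) := by
    intro a
    rw [coeff_rename_gen, ← finsum_comp_equiv (Finsupp.equivFunOnFinite
      (α := Fin r × Fin r) (M := ℕ))]
    have hterm : ∀ d : Fin r × Fin r →₀ ℕ,
        (if pv (Finsupp.equivFunOnFinite d) = D then
          Wvert (zP i) a b c (Finsupp.equivFunOnFinite d) else 0) =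
        if Finsupp.mapDomain π d = D' then
          MvPolynomial.coeff d (ZQ (zP i) b (r * r) a c) else 0 := by
      intro d
      rw [coeff_ZQ]
      have hiff : pv (Finsupp.equivFunOnFinite d) = D ↔ Finsupp.mapDomain π d = D' := by
        rw [← hDD]
        constructor
        · intro h
          ext x
          rw [hfiber]; exact congrFun h x
        · intro h
          funext x
          rw [← h, hfiber]; rfl
      exact if_congr hiff rfl rfl
    rw [finsum_congr hterm]
    refine (finsum_eq_sum_of_support_subset
      (s := (ZQ (zP i) b (r * r) a c).support) _ ?_).trans
      (Finset.sum_congr rfl (fun d _ => by split_ifs <;> rfl))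
    intro d hd
    rw [Function.mem_support] at hd
    simp only [Finset.mem_coe, MvPolynomial.mem_support_iff]
    intro h0
    apply hd
    rw [h0]; simp
  have hb1 : ∀ a, pv b (a, de') = b (a, de') + b (a, de) := by
    intro a; simp [pv, add_comm]
  have hb2 : ∀ a, pv b (a, de) = 0 := by
    intro a; simp only [pv]; rw [if_neg (Ne.symm hgf)]; simp
  have hb3 : ∀ ab : Fin r × Fin r, ab.2 ≠ de → ab.2 ≠ de' → pv b ab = b ab := by
    intro ab h1 h2; simp only [pv]; rw [if_neg h2, if_neg h1]
  have key := core_poly (zP i) b (pv b) de de' hfg hb1 hb2 hb3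
    (fun ab => MvPolynomial.rename π (MvPolynomial.X ab))
    (fun ab => MvPolynomial.bind₁ (fun s : Fin r × Fin r =>
      if s.2 = de then (0 : QR r) else MvPolynomial.X s) (MvPolynomial.X ab))
    (fun ab => by rw [MvPolynomial.rename_X])
    (fun ab => by rw [MvPolynomial.bind₁_X_right])
  have key2 := congrFun (congrFun key A) c
  rw [mul_Pm, Matrix.mul_apply] at key2
  have hR : ∀ a, MvPolynomial.rename π (ZQ (zP i) b (r * r) a c) =
      matProd (stp (MvPolynomial.C (tP r) : QR r) (MvPolynomial.C (zP i)) b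
        (fun ab => MvPolynomial.rename π (MvPolynomial.X ab))) (r * r) a c := by
    intro a
    have := Zmap (MvPolynomial.rename π : QR r →ₐ[PolyR r] QR r).toRingHom
      (MvPolynomial.C (tP r)) (MvPolynomial.C (zP i)) b MvPolynomial.X (r * r) a c
    simpa [ZQ] using this
  have hL : MvPolynomial.bind₁ (fun s : Fin r × Fin r =>
      if s.2 = de then (0 : QR r) else MvPolynomial.X s) (ZQ (zP i) (pv b) (r * r) A (ph c)) =
      matProd (stp (MvPolynomial.C (tP r) : QR r) (MvPolynomial.C (zP i)) (pv b)
        (fun ab => MvPolynomial.bind₁ (fun s : Fin r × Fin r =>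
      if s.2 = de then (0 : QR r) else MvPolynomial.X s) (MvPolynomial.X ab))) (r * r) A (ph c) := by
    have := Zmap (MvPolynomial.bind₁ (fun s : Fin r × Fin r =>
      if s.2 = de then (0 : QR r) else MvPolynomial.X s) : QR r →ₐ[PolyR r] QR r).toRingHom
      (MvPolynomial.C (tP r)) (MvPolynomial.C (zP i)) (pv b) MvPolynomial.X (r * r) A (ph c)
    simpa [ZQ] using this
  rw [← hph, ← hL] at key2
  have key3 := congrArg (MvPolynomial.coeff D') key2
  have hkill := coeff_kill (fun s : Fin r × Fin r => s.2 = de) (ZQ (zP i) (pv b) (r * r) A (ph c)) D'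
    (by
      rintro ⟨s1, s2⟩ hs
      dsimp only at hs
      rw [hDD, hs]; exact hD s1)
  have hW := coeff_ZQ (zP i) (pv b) A (ph c) D'
  rw [hDD] at hW
  have hkk : MvPolynomial.coeff D' (MvPolynomial.bind₁ (fun s : Fin r × Fin r =>
      if s.2 = de then (0 : QR r) else MvPolynomial.X s) (ZQ (zP i) (pv b) (r * r) A (ph c))) =
      ∑ a : Spin r, (if ph a = A then
            (finsum fun d : Fin r × Fin r → ℕ =>
              if pv d = D then Wvert (zP i) a b c d else 0) else 0) := by
    rw [← key3, MvPolynomial.coeff_sum]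
    apply Finset.sum_congr rfl
    intro a _
    rw [hinner, ← hR, hph]
    unfold Pm
    by_cases h : phF de de' a = A
    · rw [if_pos h, if_pos h, one_mul]
    · rw [if_neg h, if_neg h, zero_mul, MvPolynomial.coeff_zero]
  refine Eq.trans ?_ (hkk.trans (Finset.sum_congr rfl (fun a _ => by congr!)))
  rw [← hW, ← hkill]
  have hfun : ∀ (F G : Fin r × Fin r → QR r), F = G → MvPolynomial.coeff D' (MvPolynomial.bind₁ F
      (ZQ (zP i) (pv b) (r * r) A (ph c))) = MvPolynomial.coeff D' (MvPolynomial.bind₁ G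
      (ZQ (zP i) (pv b) (r * r) A (ph c))) := fun F G h => by rw [h]
  apply hfun
  funext s
  by_cases h : s.2 = de
  · rw [if_pos h, if_pos h]
  · rw [if_neg h, if_neg h]
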